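/- arXiv:1604.03270 — 2 statements merged into one kernel-verified Lean document; each statement's English description precedes it below -/
import Mathlib

section
/- Let A=(Q,Σ,δ,ρ) be a connected bireversible Mealy automaton whose orbit tree o(A) has no active self-liftable branch, and let j be a jungle tree of o(A) with trunk of length n. All the equivalence classes of the relation ∼ on stems have the same cardinality. -/
open List

variable {Q A : Type*}

/-- Action of a state on words over the alphabet:
`ρ_x(i·s) = ρ_x(i) · ρ_{δ_i(x)}(s)`. -/
def mrho (d : A → Q → Q) (r : Q → A → A) : Q → List A → List A
  | _, [] => []
  | x, i :: s => r x i :: mrho d r (d i x) s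

/-- Action of a word of states: `ρ_{x₁⋯x_m} = ρ_{x_m} ∘ ⋯ ∘ ρ_{x₁}`. -/
def mrhoW (d : A → Q → Q) (r : Q → A → A) : List Q → List A → List A
  | [], s => s
  | x :: u, s => mrhoW d r u (mrho d r x s)

/-- Dual action of a letter on words of states:
`δ_i(x·u) = δ_i(x) · δ_{ρ_x(i)}(u)`. -/
def mdel (d : A → Q → Q) (r : Q → A → A) : A → List Q → List Q
  | _, [] => []
  | i, x :: u => d i x :: mdel d r (r x i) u

/-- Action of a word of letters: `δ_{s₁⋯s_m} = δ_{s_m} ∘ ⋯ ∘ δ_{s₁}`. -/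
def mdelW (d : A → Q → Q) (r : Q → A → A) : List A → List Q → List Q
  | [], u => u
  | i :: s, u => mdelW d r s (mdel d r i u)

/-- Connected component (orbit under the dual action) of a word of states. -/
def mOrbit (d : A → Q → Q) (r : Q → A → A) (u : List Q) : Set (List Q) :=
  { v | ∃ s : List A, mdelW d r s u = v }

/-- The Mealy automaton is invertible. -/
def MInvertible (r : Q → A → A) : Prop := ∀ x : Q, Function.Bijective (r x)

/-- The Mealy automaton is reversible. -/
def MReversible (d : A → Q → Q) : Prop := ∀ i : A, Function.Bijective (d i)

/-- The Mealy automaton is connected. -/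
def MConnected (d : A → Q → Q) (r : Q → A → A) : Prop :=
  ∀ x y : Q, ∃ s : List A, mdelW d r s [x] = [y]

/-- The Mealy automaton is bireversible: invertible, reversible, and for each output
letter `j`, the map sending `x` to `δ_i(x)` (where `i` is the unique letter with
`ρ_x(i) = j`) is a permutation of the (finite) stateset, encoded as injectivity. -/
def MBireversible (d : A → Q → Q) (r : Q → A → A) : Prop :=
  MInvertible r ∧ MReversible d ∧
    ∀ (x y : Q) (i i' : A), r x i = r y i' → d i x = d i' y → x = y

/-- The edge of the orbit tree whose bottom is the component of `e` is liftable
to the edge whose bottom is the component of `f`: every word of `⊥(e)` admits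
some word of `⊥(f)` as a suffix. -/
def EdgeLiftable (d : A → Q → Q) (r : Q → A → A) (e f : List Q) : Prop :=
  ∀ v ∈ mOrbit d r e, ∃ v' ∈ mOrbit d r f, v' <:+ v

/-- Prefix of length `m` of the infinite word `α : ℕ → Q`. -/
def branchPrefix (α : ℕ → Q) (m : ℕ) : List Q := (List.range m).map α

/-- The orbit tree admits an active self-liftable branch: a branch, represented by
an infinite word `α`, which is `k`-self-liftable for some `k ≥ 1` (every edge at
level `j + k` of the branch is liftable to the edge at level `j`), and active
(its label sequence is not eventually `1`, i.e. the sizes of the components of the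
prefixes do not become eventually constant). -/
def HasActiveSelfLiftableBranch (d : A → Q → Q) (r : Q → A → A) : Prop :=
  ∃ (α : ℕ → Q) (k : ℕ), 1 ≤ k ∧
    (∀ j : ℕ, 1 ≤ j → EdgeLiftable d r (branchPrefix α (j + k)) (branchPrefix α j)) ∧
    ∀ N : ℕ, ∃ m : ℕ, N ≤ m ∧
      (mOrbit d r (branchPrefix α (m + 1))).ncard ≠ (mOrbit d r (branchPrefix α m)).ncard

/-- `t` represents the trunk of a jungle tree: a non-empty finite initial
`1`-self-liftable path (each edge of the trunk is liftable to the preceding one)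
such that the bottom of the trunk has at least two legitimate children
(children liftable to the last trunk edge), and every legitimate child has label `1`. -/
def IsJungleTrunk (d : A → Q → Q) (r : Q → A → A) (t : List Q) : Prop :=
  t ≠ [] ∧
  (∀ j : ℕ, 2 ≤ j → j ≤ t.length → EdgeLiftable d r (t.take j) (t.take (j - 1))) ∧
  (∃ x y : Q, mOrbit d r (t ++ [x]) ≠ mOrbit d r (t ++ [y]) ∧
    EdgeLiftable d r (t ++ [x]) t ∧ EdgeLiftable d r (t ++ [y]) t) ∧
  ∀ x : Q, EdgeLiftable d r (t ++ [x]) t →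
    (mOrbit d r (t ++ [x])).ncard = (mOrbit d r t).ncard

/-- `u` is a `j`-word for the jungle tree with trunk `t`: the sequence of connected
components of the prefixes of `u` is an initial path of the jungle tree, i.e. the
component of each prefix of length `i ≤ |t|` coincides with the component of the
corresponding trunk prefix, and each deeper edge is liftable to the last trunk edge. -/
def IsJWord (d : A → Q → Q) (r : Q → A → A) (t u : List Q) : Prop :=
  (∀ i : ℕ, i ≤ u.length → i ≤ t.length → u.take i ∈ mOrbit d r (t.take i)) ∧
  ∀ l : ℕ, t.length ≤ l → l < u.length → EdgeLiftable d r (u.take (l + 1)) t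

/-- A stem is a `j`-word whose length is the length of the trunk. -/
def IsStem (d : A → Q → Q) (r : Q → A → A) (t u : List Q) : Prop :=
  IsJWord d r t u ∧ u.length = t.length

/-- A cyclic `j`-word is a finite word all of whose powers are `j`-words. -/
def IsCyclicJWord (d : A → Q → Q) (r : Q → A → A) (t u : List Q) : Prop :=
  ∀ k : ℕ, IsJWord d r t (List.flatten (List.replicate k u))

/-- The relation `∼` on stems: `u ∼ v` whenever there is `s` such that `u·s·v` is a
`j`-word and `ρ_{u·s}` acts like the identity on `Σ*`. -/
def StemEquiv (d : A → Q → Q) (r : Q → A → A) (t u v : List Q) : Prop :=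
  ∃ s : List Q, IsJWord d r t (u ++ s ++ v) ∧ ∀ w : List A, mrhoW d r (u ++ s) w = w

def rhoL (r : Q → A → A) : List Q → A → A
  | [], i => i
  | x :: u, i => rhoL r u (r x i)

theorem mrhoW_cons' (d : A → Q → Q) (r : Q → A → A) (u : List Q) (i : A) (s : List A) :
    mrhoW d r u (i :: s) = rhoL r u i :: mrhoW d r (mdel d r i u) s := by
  induction u generalizing i s with
  | nil => rfl
  | cons x u ih => simp only [mrhoW, mrho, mdel, rhoL, ih]

theorem mdel_append' (d : A → Q → Q) (r : Q → A → A) (u w : List Q) (i : A) :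
    mdel d r i (u ++ w) = mdel d r i u ++ mdel d r (rhoL r u i) w := by
  induction u generalizing i with
  | nil => rfl
  | cons x u ih => simp only [mdel, rhoL, ih, List.cons_append]

theorem mdel_length' (d : A → Q → Q) (r : Q → A → A) (u : List Q) (i : A) :
    (mdel d r i u).length = u.length := by
  induction u generalizing i with
  | nil => rfl
  | cons x u ih => simp only [mdel, ih, List.length_cons]

theorem mdel_take' (d : A → Q → Q) (r : Q → A → A) (u : List Q) (i : A) (k : ℕ) :
    (mdel d r i u).take k = mdel d r i (u.take k) := by
  induction u generalizing i k with
  | nil => simp [mdel]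
  | cons x u ih => cases k <;> simp [mdel, ih]

theorem mdel_inj' (d : A → Q → Q) (r : Q → A → A) (h : MReversible d) (i : A) :
    Function.Injective (mdel d r i) := by
  intro u
  induction u generalizing i with
  | nil => intro v hv; cases v <;> simp_all [mdel]
  | cons x u ih =>
    intro v hv
    cases v with
    | nil => simp [mdel] at hv
    | cons y v =>
      simp only [mdel, List.cons.injEq] at hv
      obtain rfl := (h i).1 hv.1
      rw [ih _ hv.2]

theorem mdelW_append' (d : A → Q → Q) (r : Q → A → A) (s s' : List A) (u : List Q) :
    mdelW d r (s ++ s') u = mdelW d r s' (mdelW d r s u) := by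
  induction s generalizing u with
  | nil => rfl
  | cons i s ih => simp only [mdelW, ih, List.cons_append]

theorem mdelW_length' (d : A → Q → Q) (r : Q → A → A) (s : List A) (u : List Q) :
    (mdelW d r s u).length = u.length := by
  induction s generalizing u with
  | nil => rfl
  | cons i s ih => simp only [mdelW, ih, mdel_length']

theorem mdelW_inj' (d : A → Q → Q) (r : Q → A → A) (h : MReversible d) (s : List A) :
    Function.Injective (mdelW d r s) := by
  induction s with
  | nil => intro u v h; exact h
  | cons i s ih => intro u v huv; exact mdel_inj' d r h i (ih huv)

theorem mdelW_iter' (d : A → Q → Q) (r : Q → A → A) (s : List A) (u : List Q) (k : ℕ) :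
    ∃ s', mdelW d r s' u = (mdelW d r s)^[k] u := by
  induction k with
  | zero => exact ⟨[], rfl⟩
  | succ k ih =>
    obtain ⟨s', hs⟩ := ih
    exact ⟨s' ++ s, by rw [mdelW_append', hs, Function.iterate_succ_apply']⟩

theorem orbit_symm' [Finite Q] (d : A → Q → Q) (r : Q → A → A) (h : MReversible d)
    (u v : List Q) (hv : v ∈ mOrbit d r u) : u ∈ mOrbit d r v := by
  obtain ⟨s, rfl⟩ := hv
  have hl : ∀ k : ℕ, (mdelW d r s)^[k] u ∈ {l : List Q | l.length = u.length} := by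
    intro k
    obtain ⟨s', hs⟩ := mdelW_iter' d r s u k
    rw [← hs]; exact mdelW_length' d r s' u
  obtain ⟨a, b, hab, heq⟩ :=
    Set.Finite.exists_lt_map_eq_of_forall_mem hl (List.finite_length_eq Q u.length)
  obtain ⟨c, rfl⟩ := Nat.exists_eq_add_of_lt hab
  have h2 : u = (mdelW d r s)^[c + 1] u := by
    apply (mdelW_inj' d r h s).iterate a
    rw [← Function.iterate_add_apply, ← add_assoc]; exact heq
  rw [Function.iterate_succ_apply] at h2
  obtain ⟨s', hs⟩ := mdelW_iter' d r s (mdelW d r s u) c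
  exact ⟨s', by rw [hs, ← h2]⟩

theorem mdel_jword' (d : A → Q → Q) (r : Q → A → A) (t u : List Q) (i : A)
    (h : IsJWord d r t u) : IsJWord d r t (mdel d r i u) := by
  refine ⟨fun k hk hkt => ?_, fun l hl hlu => ?_⟩
  · rw [mdel_length'] at hk
    obtain ⟨s, hs⟩ := h.1 k hk hkt
    exact ⟨s ++ [i], by rw [mdelW_append', hs, mdel_take']; rfl⟩
  · rw [mdel_length'] at hlu
    rintro w ⟨s, rfl⟩
    refine h.2 l hl hlu _ ⟨i :: s, ?_⟩
    rw [mdel_take']; rfl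

theorem mdel_stemEquiv' (d : A → Q → Q) (r : Q → A → A) (t u v : List Q) (i : A)
    (h : StemEquiv d r t u v) : StemEquiv d r t (mdel d r i u) (mdel d r i v) := by
  obtain ⟨s, hj, hid⟩ := h
  have h1 := hid [i]
  rw [mrhoW_cons'] at h1
  have hi : rhoL r (u ++ s) i = i := (List.cons.inj h1).1
  have e := mdel_append' d r u s i
  refine ⟨mdel d r (rhoL r u i) s, ?_, fun w => ?_⟩
  · have := mdel_jword' d r t _ i hj
    rwa [mdel_append', hi, e] at this
  · have h2 := hid (i :: w)
    rw [mrhoW_cons', e] at h2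
    exact (List.cons.inj h2).2

theorem class_le' [Finite Q] (d : A → Q → Q) (r : Q → A → A) (h : MReversible d)
    (t : List Q) (s : List A) (u : List Q) :
    {w : List Q | IsStem d r t w ∧ StemEquiv d r t u w}.ncard ≤
      {w : List Q | IsStem d r t w ∧ StemEquiv d r t (mdelW d r s u) w}.ncard := by
  induction s generalizing u with
  | nil => exact le_rfl
  | cons i s ih =>
    refine le_trans ?_ (ih (mdel d r i u))
    refine Set.ncard_le_ncard_of_injOn (mdel d r i) ?_ (mdel_inj' d r h i).injOn
      ((List.finite_length_eq Q t.length).subset fun w hw => hw.1.2)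
    rintro w ⟨⟨hw, hl⟩, he⟩
    exact ⟨⟨mdel_jword' d r t w i hw, by rw [mdel_length', hl]⟩,
      mdel_stemEquiv' d r t u w i he⟩

theorem stem_orbit' (d : A → Q → Q) (r : Q → A → A) (t u : List Q) (h : IsStem d r t u) :
    u ∈ mOrbit d r t := by
  have := h.1.1 t.length h.2.ge le_rfl
  rwa [List.take_length, ← h.2, List.take_length] at this

theorem class_le_stem' [Finite Q] (d : A → Q → Q) (r : Q → A → A) (h : MReversible d)
    (t u v : List Q) (hu : IsStem d r t u) (hv : IsStem d r t v) :
    {w : List Q | IsStem d r t w ∧ StemEquiv d r t u w}.ncard ≤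
      {w : List Q | IsStem d r t w ∧ StemEquiv d r t v w}.ncard := by
  obtain ⟨s, hs⟩ := orbit_symm' d r h _ _ (stem_orbit' d r t u hu)
  obtain ⟨s', rfl⟩ := stem_orbit' d r t v hv
  have := class_le' d r h t (s ++ s') u
  rwa [mdelW_append', hs] at this

/-- All the equivalence classes of `∼` on stems have the same cardinality. -/
theorem statement13 [Fintype Q] [Fintype A] [Nonempty Q] [Nonempty A]
    (d : A → Q → Q) (r : Q → A → A)
    (hbi : MBireversible d r) (hconn : MConnected d r)
    (hnab : ¬ HasActiveSelfLiftableBranch d r)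
    (t : List Q) (ht : IsJungleTrunk d r t)
    (u v : List Q) (hu : IsStem d r t u) (hv : IsStem d r t v) :
    {w : List Q | IsStem d r t w ∧ StemEquiv d r t u w}.ncard =
      {w : List Q | IsStem d r t w ∧ StemEquiv d r t v w}.ncard := by
  exact le_antisymm (class_le_stem' d r hbi.2.1 t u v hu hv)
    (class_le_stem' d r hbi.2.1 t v u hv hu)
end

section
/- Let A=(Q,Σ,δ,ρ) be a connected bireversible Mealy automaton whose orbit tree o(A) has no active self-liftable branch, and let j be a jungle tree of o(A) with trunk of length n. Define the relation ∧_0 on stems by: u ∧_0 v if there exists a stem s such that both s·u and s·v are j-words, and let ∧ be the transitive closure of ∧_0. Then ∧ is finer than ∼: for all stems u,v, u ∧ v implies u ∼ v. -/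
open List

variable {Q A : Type*}

theorem aux_mdelW_cons (d : A → Q → Q) (r : Q → A → A) (s : List A) :
    ∀ (x : Q) (u : List Q),
      mdelW d r s (x :: u) = mdelW d r s [x] ++ mdelW d r (mrho d r x s) u := by
  induction s with
  | nil => intro x u; rfl
  | cons i s ih =>
    intro x u
    exact ih (d i x) (mdel d r (r x i) u)

theorem aux_mdelW_nil (d : A → Q → Q) (r : Q → A → A) (s : List A) :
    mdelW d r s [] = [] := by
  induction s with
  | nil => rfl
  | cons i s ih => exact ih

theorem aux_mdelW_append (d : A → Q → Q) (r : Q → A → A) (p : List Q) :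
    ∀ (s : List A) (b : List Q),
      mdelW d r s (p ++ b) = mdelW d r s p ++ mdelW d r (mrhoW d r p s) b := by
  induction p with
  | nil => intro s b; rw [aux_mdelW_nil]; rfl
  | cons x p ih =>
    intro s b
    rw [List.cons_append, aux_mdelW_cons, ih, aux_mdelW_cons d r s x p, List.append_assoc]
    rfl

theorem aux_mrhoW_cons (d : A → Q → Q) (r : Q → A → A) (w : List Q) :
    ∀ (i : A) (s : List A),
      mrhoW d r w (i :: s) = mrhoW d r w [i] ++ mrhoW d r (mdel d r i w) s := by
  induction w with
  | nil => intro i s; rfl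
  | cons x w ih => intro i s; exact ih (r x i) (mrho d r (d i x) s)

theorem aux_mrhoW_append (d : A → Q → Q) (r : Q → A → A) (p : List Q) :
    ∀ (q : List Q) (s : List A), mrhoW d r (p ++ q) s = mrhoW d r q (mrhoW d r p s) := by
  induction p with
  | nil => intro q s; rfl
  | cons x p ih => intro q s; exact ih q _

theorem aux_mdel_length (d : A → Q → Q) (r : Q → A → A) (u : List Q) :
    ∀ i, (mdel d r i u).length = u.length := by
  induction u with
  | nil => intro i; rfl
  | cons x u ih => intro i; simp [mdel, ih]

theorem aux_mdelW_length (d : A → Q → Q) (r : Q → A → A) (s : List A) :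
    ∀ u, (mdelW d r s u).length = u.length := by
  induction s with
  | nil => intro u; rfl
  | cons i s ih => intro u; simp [mdelW, ih, aux_mdel_length]

theorem aux_mrho_length (d : A → Q → Q) (r : Q → A → A) (s : List A) :
    ∀ x, (mrho d r x s).length = s.length := by
  induction s with
  | nil => intro i; rfl
  | cons x u ih => intro i; simp [mrho, ih]

theorem aux_mrhoW_length (d : A → Q → Q) (r : Q → A → A) (w : List Q) :
    ∀ s, (mrhoW d r w s).length = s.length := by
  induction w with
  | nil => intro u; rfl
  | cons i s ih => intro u; simp [mrhoW, ih, aux_mrho_length]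

theorem aux_mrho_bij (d : A → Q → Q) (r : Q → A → A) (hi : MInvertible r) (x : Q) :
    Function.Bijective (mrho d r x) := by
  constructor
  · intro s
    induction s generalizing x with
    | nil =>
      intro s' h
      cases s' with
      | nil => rfl
      | cons a b => simp [mrho] at h
    | cons i s ih =>
      intro s' h
      cases s' with
      | nil => simp [mrho] at h
      | cons a b =>
        simp only [mrho, List.cons.injEq] at h
        have h1 := (hi x).1 h.1
        subst h1
        rw [ih _ h.2]
  · intro s
    induction s generalizing x with
    | nil => exact ⟨[], rfl⟩
    | cons i s ih =>
      obtain ⟨a, ha⟩ := (hi x).2 i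
      obtain ⟨b, hb⟩ := ih (d a x)
      exact ⟨a :: b, by simp [mrho, ha, hb]⟩

theorem aux_mrhoW_bij (d : A → Q → Q) (r : Q → A → A) (hi : MInvertible r) (w : List Q) :
    Function.Bijective (mrhoW d r w) := by
  induction w with
  | nil => exact Function.bijective_id
  | cons x w ih => exact ih.comp (aux_mrho_bij d r hi x)

theorem aux_mdel_inj (d : A → Q → Q) (r : Q → A → A) (hr : MReversible d) (i : A) :
    Function.Injective (mdel d r i) := by
  intro u
  induction u generalizing i with
  | nil =>
    intro u' h
    cases u' with
    | nil => rfl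
    | cons a b => simp [mdel] at h
  | cons x u ih =>
    intro u' h
    cases u' with
    | nil => simp [mdel] at h
    | cons a b =>
      simp only [mdel, List.cons.injEq] at h
      have h1 := (hr i).1 h.1
      subst h1
      rw [ih _ h.2]

theorem aux_orbit_refl (d : A → Q → Q) (r : Q → A → A) (u : List Q) : u ∈ mOrbit d r u :=
  ⟨[], rfl⟩

theorem aux_mdelW_append_left (d : A → Q → Q) (r : Q → A → A) (s : List A) :
    ∀ (s' : List A) (u : List Q), mdelW d r (s ++ s') u = mdelW d r s' (mdelW d r s u) := by
  induction s with
  | nil => intro s' u; rfl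
  | cons i s ih => intro s' u; exact ih s' _

theorem aux_orbit_trans (d : A → Q → Q) (r : Q → A → A) {u v w : List Q}
    (h1 : v ∈ mOrbit d r u) (h2 : w ∈ mOrbit d r v) : w ∈ mOrbit d r u := by
  obtain ⟨s, rfl⟩ := h1
  obtain ⟨s', rfl⟩ := h2
  exact ⟨s ++ s', aux_mdelW_append_left d r s s' u⟩

theorem aux_orbit_length (d : A → Q → Q) (r : Q → A → A) {u v : List Q}
    (h : v ∈ mOrbit d r u) : v.length = u.length := by
  obtain ⟨s, rfl⟩ := h
  exact aux_mdelW_length d r s u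

theorem aux_orbit_finite [Fintype Q] (d : A → Q → Q) (r : Q → A → A) (u : List Q) :
    (mOrbit d r u).Finite :=
  (List.finite_length_eq Q u.length).subset fun _ hv => aux_orbit_length d r hv

theorem aux_orbit_symm_one [Fintype Q] (d : A → Q → Q) (r : Q → A → A) (hr : MReversible d)
    (i : A) (u : List Q) : u ∈ mOrbit d r (mdel d r i u) := by
  have : Finite {l : List Q // l.length = u.length} := (List.finite_length_eq Q u.length)
  let f : {l : List Q // l.length = u.length} → {l : List Q // l.length = u.length} :=
    fun l => ⟨mdel d r i l.1, by rw [aux_mdel_length, l.2]⟩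
  have hf : Function.Injective f := by
    intro a b h
    exact Subtype.ext (aux_mdel_inj d r hr i (congrArg Subtype.val h))
  have key : ∀ (k : ℕ) (a : {l : List Q // l.length = u.length}),
      (f^[k] a).1 ∈ mOrbit d r a.1 := by
    intro k
    induction k with
    | zero => intro a; exact aux_orbit_refl d r _
    | succ k ih => intro a; exact aux_orbit_trans d r ⟨[i], rfl⟩ (ih (f a))
  obtain ⟨k, hk, hp⟩ := hf.mem_periodicPts ⟨u, rfl⟩
  obtain ⟨k, rfl⟩ := Nat.exists_eq_succ_of_ne_zero (Nat.pos_iff_ne_zero.1 hk)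
  have h := key k (f ⟨u, rfl⟩)
  have h2 : f^[k] (f ⟨u, rfl⟩) = ⟨u, rfl⟩ := hp
  rw [h2] at h
  exact h

theorem aux_orbit_symm [Fintype Q] (d : A → Q → Q) (r : Q → A → A) (hr : MReversible d)
    {u v : List Q} (h : v ∈ mOrbit d r u) : u ∈ mOrbit d r v := by
  obtain ⟨s, rfl⟩ := h
  induction s generalizing u with
  | nil => exact aux_orbit_refl d r _
  | cons i s ih => exact aux_orbit_trans d r (ih (u := mdel d r i u)) (aux_orbit_symm_one d r hr i u)

theorem aux_orbit_eq [Fintype Q] (d : A → Q → Q) (r : Q → A → A) (hr : MReversible d)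
    {u v : List Q} (h : v ∈ mOrbit d r u) : mOrbit d r v = mOrbit d r u := by
  ext w
  exact ⟨fun h' => aux_orbit_trans d r h h',
    fun h' => aux_orbit_trans d r (aux_orbit_symm d r hr h) h'⟩

/-- prefixes and suffixes of orbit elements -/
theorem aux_orbit_append (d : A → Q → Q) (r : Q → A → A) {p q p' q' : List Q}
    (h : p' ++ q' ∈ mOrbit d r (p ++ q)) (hl : p'.length = p.length) :
    p' ∈ mOrbit d r p ∧ q' ∈ mOrbit d r q := by
  obtain ⟨s, hs⟩ := h
  rw [aux_mdelW_append] at hs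
  obtain ⟨h1, h2⟩ := List.append_inj hs (by rw [aux_mdelW_length, hl])
  exact ⟨⟨_, h1⟩, ⟨_, h2⟩⟩

theorem aux_take_mem (d : A → Q → Q) (r : Q → A → A) {w w' : List Q} (k : ℕ)
    (h : w' ∈ mOrbit d r w) : w'.take k ∈ mOrbit d r (w.take k) := by
  have hl := aux_orbit_length d r h
  rw [← List.take_append_drop k w, ← List.take_append_drop k w'] at h
  exact (aux_orbit_append d r h (by simp [hl])).1

theorem aux_drop_mem (d : A → Q → Q) (r : Q → A → A) {w w' : List Q} (k : ℕ)
    (h : w' ∈ mOrbit d r w) : w'.drop k ∈ mOrbit d r (w.drop k) := by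
  have hl := aux_orbit_length d r h
  rw [← List.take_append_drop k w, ← List.take_append_drop k w'] at h
  exact (aux_orbit_append d r h (by simp [hl])).2

/-- all factors of trunk length lie in the orbit of the trunk -/
def JF (d : A → Q → Q) (r : Q → A → A) (t w : List Q) : Prop :=
  ∀ k, k + t.length ≤ w.length → (w.drop k).take t.length ∈ mOrbit d r t

theorem JF_orbit (d : A → Q → Q) (r : Q → A → A) {t w w' : List Q} (h : JF d r t w)
    (hw : w' ∈ mOrbit d r w) : JF d r t w' := by
  intro k hk
  rw [aux_orbit_length d r hw] at hk
  exact aux_orbit_trans d r (h k hk) (aux_take_mem d r _ (aux_drop_mem d r k hw))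

theorem JF_left (d : A → Q → Q) (r : Q → A → A) {t p q : List Q} (h : JF d r t (p ++ q)) :
    JF d r t p := by
  intro k hk
  have := h k (by simp; omega)
  rwa [List.drop_append_of_le_length (by omega),
    List.take_append_of_le_length (by simp; omega)] at this

theorem JF_concat (d : A → Q → Q) (r : Q → A → A) {t p v q : List Q}
    (h1 : JF d r t (p ++ v)) (h2 : JF d r t (v ++ q)) (hv : v.length = t.length) :
    JF d r t (p ++ v ++ q) := by
  intro k hk
  by_cases hc : k ≤ p.length
  · have := h1 k (by simp; omega)
    rwa [List.drop_append_of_le_length (by simp; omega),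
      List.take_append_of_le_length (by simp; omega)]
  · have := h2 (k - p.length) (by simp at hk ⊢; omega)
    rw [List.append_assoc, List.drop_append, List.drop_eq_nil_of_le (by omega)]
    exact this

theorem JF_of_isJWord (d : A → Q → Q) (r : Q → A → A) {t w : List Q}
    (h : IsJWord d r t w) : JF d r t w := by
  intro k hk
  rcases Nat.eq_zero_or_pos k with rfl | hpos
  · have := h.1 t.length (by omega) le_rfl
    simpa using this
  · by_cases h0 : t.length = 0
    · have : t = [] := List.length_eq_zero_iff.1 h0
      subst this
      exact aux_orbit_refl d r []
    obtain ⟨v', hv', hs⟩ := h.2 (k + t.length - 1) (by omega) (by omega) _ (aux_orbit_refl d r _)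
    have hl := aux_orbit_length d r hv'
    rw [show k + t.length - 1 + 1 = k + t.length by omega] at hs
    rw [List.suffix_iff_eq_drop] at hs
    rw [List.take_drop]
    rw [hs, List.length_take, hl, min_eq_left (by omega), Nat.add_sub_cancel] at hv'
    exact hv'

theorem liftable_of_JF (d : A → Q → Q) (r : Q → A → A) {t w : List Q}
    (h : JF d r t w) (hl : t.length ≤ w.length) : EdgeLiftable d r w t := by
  intro v hv
  have h' := JF_orbit d r h hv
  have hvl := aux_orbit_length d r hv
  refine ⟨v.drop (v.length - t.length), ?_, List.drop_suffix _ _⟩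
  have := h' (v.length - t.length) (by omega)
  rwa [List.take_of_length_le (by simp; omega)] at this

theorem isJWord_of_JF (d : A → Q → Q) (r : Q → A → A) {t w : List Q}
    (h : JF d r t w) (hl : t.length ≤ w.length) : IsJWord d r t w := by
  constructor
  · intro i _ hi
    have := aux_take_mem d r i (h 0 (by omega))
    rwa [List.drop_zero, List.take_take, min_eq_left hi] at this
  · intro l h1 h2
    apply liftable_of_JF d r _ (by simp; omega)
    have : JF d r t (w.take (l+1) ++ w.drop (l+1)) := by rwa [List.take_append_drop]
    exact JF_left d r this

theorem edge_det [Fintype Q] (d : A → Q → Q) (r : Q → A → A) (hr : MReversible d)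
    {t : List Q} (ht : IsJungleTrunk d r t) {a : List Q} {x y : Q} (hal : a.length = t.length)
    (h : JF d r t (a ++ [x])) (hy : a ++ [y] ∈ mOrbit d r (a ++ [x])) : y = x := by
  have ha : a ∈ mOrbit d r t := by
    have := h 0 (by simp; omega)
    rwa [List.drop_zero, ← hal, List.take_left] at this
  obtain ⟨s, hs⟩ := aux_orbit_symm d r hr ha
  have h1 : mdelW d r s (a ++ [x]) ∈ mOrbit d r (a ++ [x]) := ⟨s, rfl⟩
  have h2 := h1
  rw [aux_mdelW_append, hs] at h2
  have hl1 : (mdelW d r (mrhoW d r a s) [x]).length = 1 := by rw [aux_mdelW_length]; rfl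
  obtain ⟨x0, hx0⟩ := List.length_eq_one_iff.1 hl1
  rw [hx0] at h2
  have hJ := JF_orbit d r h h2
  have hc := ht.2.2.2 x0 (liftable_of_JF d r hJ (by simp))
  have himg : List.dropLast '' mOrbit d r (t ++ [x0]) = mOrbit d r t := by
    ext w
    constructor
    · rintro ⟨w', hw', rfl⟩
      have := aux_take_mem d r t.length hw'
      rw [List.take_left] at this
      rw [List.dropLast_eq_take, aux_orbit_length d r hw']
      simpa using this
    · rintro ⟨s', rfl⟩
      refine ⟨_, ⟨s', rfl⟩, ?_⟩
      rw [aux_mdelW_append, List.dropLast_eq_take, List.length_append,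
        aux_mdelW_length _ _ _ [x0]]
      simp
  have hinj : Set.InjOn List.dropLast (mOrbit d r (t ++ [x0])) :=
    Set.injOn_of_ncard_image_eq (by rw [himg, hc]) (aux_orbit_finite d r _)
  have he := aux_orbit_eq d r hr h2
  have := hinj (by rw [he]; exact hy) (by rw [he]; exact aux_orbit_refl d r _) (by simp)
  simpa using this

theorem det_one [Fintype Q] (d : A → Q → Q) (r : Q → A → A) (hr : MReversible d)
    {t : List Q} (ht : IsJungleTrunk d r t) (w : List Q) :
    ∀ w', JF d r t w → t.length ≤ w.length → w' ∈ mOrbit d r w →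
      w'.take t.length = w.take t.length → w' = w := by
  induction w using List.reverseRecOn with
  | nil =>
    intro w' _ _ h _
    exact List.length_eq_zero_iff.1 (aux_orbit_length d r h)
  | append_singleton w x ih =>
    intro w' hJ hl h htk
    have hwl := aux_orbit_length d r h
    by_cases hc : t.length ≤ w.length
    · have h1 := aux_take_mem d r w.length h
      rw [List.take_left] at h1
      have hw0 : w'.take w.length = w := by
        apply ih _ (JF_left d r hJ) hc h1
        rw [List.take_take, min_eq_left hc, htk, List.take_append_of_le_length hc]
      have hdl : (w'.drop w.length).length = 1 := by simp [hwl]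
      obtain ⟨y, hy⟩ := List.length_eq_one_iff.1 hdl
      have hw' : w' = w ++ [y] := by
        have := List.take_append_drop w.length w'
        rw [hw0, hy] at this
        exact this.symm
      subst hw'
      have h3 := aux_drop_mem d r (w.length - t.length) h
      rw [List.drop_append_of_le_length (by omega), List.drop_append_of_le_length (by omega)] at h3
      have hJ' : JF d r t (w.drop (w.length - t.length) ++ [x]) := by
        intro k hk
        have := hJ (w.length - t.length + k) (by simp at hk ⊢; omega)
        rwa [← List.drop_drop, List.drop_append_of_le_length (by omega)] at this
      rw [edge_det d r hr ht (by simp; omega) hJ' h3]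
    · have hlen : (w ++ [x]).length = w.length + 1 := by simp
      rwa [List.take_of_length_le (by omega), List.take_of_length_le (by omega)] at htk

/-- the output table of the component of `w` -/
def outR (d : A → Q → Q) (r : Q → A → A) (n : ℕ) (w : List Q) :
    Set (List Q × A × List A) :=
  {z | ∃ w' ∈ mOrbit d r w, w'.take n = z.1 ∧ mrhoW d r w' [z.2.1] = z.2.2}

theorem rho_eq_of_outR [Fintype Q] (d : A → Q → Q) (r : Q → A → A) (hr : MReversible d)
    {t : List Q} (ht : IsJungleTrunk d r t) (s : List A) :
    ∀ w1 w2 : List Q, JF d r t w1 → JF d r t w2 → t.length ≤ w1.length → t.length ≤ w2.length →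
      outR d r t.length w1 = outR d r t.length w2 → w1.take t.length = w2.take t.length →
      mrhoW d r w1 s = mrhoW d r w2 s := by
  induction s with
  | nil =>
    intro w1 w2 _ _ _ _ _ _
    rw [List.length_eq_zero_iff.1 (aux_mrhoW_length d r w1 []),
      List.length_eq_zero_iff.1 (aux_mrhoW_length d r w2 [])]
  | cons i s ih =>
    intro w1 w2 J1 J2 l1 l2 hR hk
    rw [aux_mrhoW_cons, aux_mrhoW_cons d r w2]
    have m1 : mdel d r i w1 ∈ mOrbit d r w1 := ⟨[i], rfl⟩
    have m2 : mdel d r i w2 ∈ mOrbit d r w2 := ⟨[i], rfl⟩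
    congr 1
    · have : (w1.take t.length, i, mrhoW d r w1 [i]) ∈ outR d r t.length w1 :=
        ⟨w1, aux_orbit_refl d r _, rfl, rfl⟩
      rw [hR] at this
      obtain ⟨w', hw', e1, e2⟩ := this
      have := det_one d r hr ht w2 w' J2 l2 hw' (by rw [← hk]; exact e1)
      subst this
      exact e2.symm
    · apply ih _ _ (JF_orbit d r J1 m1) (JF_orbit d r J2 m2) (by rwa [aux_mdel_length])
        (by rwa [aux_mdel_length])
      · unfold outR
        rw [aux_orbit_eq d r hr m1, aux_orbit_eq d r hr m2]
        exact hR
      · have key : ∀ w : List Q, t.length ≤ w.length →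
            (mdel d r i w).take t.length = mdelW d r [i] (w.take t.length) := by
          intro w hw
          have h1 : mdel d r i w = mdelW d r [i] (w.take t.length ++ w.drop t.length) := by
            rw [List.take_append_drop]; rfl
          rw [h1, aux_mdelW_append, List.take_left']
          rw [aux_mdelW_length]; simp; omega
        rw [key _ l1, key _ l2, hk]

/-- powers of a word -/
def wpow (c : List Q) : ℕ → List Q
  | 0 => []
  | k + 1 => c ++ wpow c k

theorem wpow_add (c : List Q) (k l : ℕ) : wpow c (k + l) = wpow c k ++ wpow c l := by
  induction k with
  | zero => simp [wpow]
  | succ k ih => rw [Nat.succ_add]; simp [wpow, ih]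

theorem wpow_succ' (c : List Q) (k : ℕ) : wpow c (k + 1) = wpow c k ++ c := by
  rw [wpow_add]; simp [wpow]

theorem exists_order [Fintype Q] [Fintype A] (d : A → Q → Q) (r : Q → A → A)
    (hi : MInvertible r) (hr : MReversible d)
    {t : List Q} (ht : IsJungleTrunk d r t) (c : List Q) (hc : t.length ≤ c.length)
    (hJ : ∀ k, JF d r t (wpow c k)) :
    ∃ k, ∀ s, mrhoW d r (wpow c (k + 1)) s = s := by
  have hfin : ({l : List Q | l.length = t.length} ×ˢ ((Set.univ : Set A) ×ˢ
      {l : List A | l.length = 1})).Finite :=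
    (List.finite_length_eq Q t.length).prod (Set.finite_univ.prod (List.finite_length_eq A 1))
  have hlen : ∀ k, t.length ≤ (wpow c (k + 1)).length := by
    intro k; simp [wpow]; omega
  have hmaps : Set.MapsTo (fun k : ℕ => outR d r t.length (wpow c (k + 1))) Set.univ
      {b | b ⊆ ({l : List Q | l.length = t.length} ×ˢ ((Set.univ : Set A) ×ˢ
      {l : List A | l.length = 1}))} := by
    intro k _
    rintro ⟨a, i, o⟩ ⟨w', hw', e1, e2⟩
    refine ⟨?_, trivial, ?_⟩
    · simp only at e1
      have := aux_orbit_length d r hw'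
      have := hlen k
      simp only [Set.mem_setOf_eq, ← e1, List.length_take]
      omega
    · simp only at e2
      simp only [Set.mem_setOf_eq, ← e2, aux_mrhoW_length]
      rfl
  obtain ⟨k, -, l, -, hkl, heq⟩ :=
    Set.infinite_univ.exists_lt_map_eq_of_mapsTo hmaps hfin.finite_subsets
  obtain ⟨m, rfl⟩ := Nat.exists_eq_add_of_lt hkl
  refine ⟨m, fun s => ?_⟩
  have h1 := rho_eq_of_outR d r hr ht s _ _ (hJ _) (hJ _) (hlen _) (hlen _) heq (by
    simp only [wpow]
    rw [List.take_append_of_le_length hc, List.take_append_of_le_length hc])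
  rw [show k + m + 1 + 1 = (m + 1) + (k + 1) by omega, wpow_add c (m + 1), aux_mrhoW_append] at h1
  exact ((aux_mrhoW_bij d r hi _).1 h1).symm

theorem exists_return [Fintype Q] (d : A → Q → Q) (r : Q → A → A)
    (hi : MInvertible r) (hr : MReversible d)
    {t : List Q} (ht : IsJungleTrunk d r t) {s u : List Q}
    (hs : s ∈ mOrbit d r t) (hu : u ∈ mOrbit d r t) (hJ : JF d r t (s ++ u)) :
    ∃ z, JF d r t (u ++ z ++ s) := by
  have hsl := aux_orbit_length d r hs
  have hul := aux_orbit_length d r hu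
  have : Finite (mOrbit d r t) := aux_orbit_finite d r t
  have hex : ∀ a : mOrbit d r t, ∃ b : mOrbit d r t, a.1 ++ b.1 ∈ mOrbit d r (s ++ u) := by
    rintro ⟨a, ha⟩
    obtain ⟨σ, hσ⟩ := aux_orbit_trans d r (aux_orbit_symm d r hr hs) ha
    refine ⟨⟨mdelW d r (mrhoW d r s σ) u, aux_orbit_trans d r hu ⟨_, rfl⟩⟩, σ, ?_⟩
    rw [aux_mdelW_append, hσ]
  choose f hf using hex
  have hdet : ∀ (a : mOrbit d r t) (b : List Q), a.1 ++ b ∈ mOrbit d r (s ++ u) → b = (f a).1 := by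
    intro a b hb
    have hal := aux_orbit_length d r a.2
    have h1 := hf a
    have he := aux_orbit_eq d r hr h1
    rw [← he] at hb
    have := det_one d r hr ht _ _ (JF_orbit d r hJ h1) (by simp; omega) hb (by
      rw [← hal, List.take_left, List.take_left])
    exact List.append_cancel_left this
  have hsurj : Function.Surjective f := by
    rintro ⟨b, hb⟩
    obtain ⟨τ, hτ⟩ := aux_orbit_trans d r (aux_orbit_symm d r hr hu) hb
    obtain ⟨σ, hσ⟩ := (aux_mrhoW_bij d r hi s).2 τ
    refine ⟨⟨mdelW d r σ s, aux_orbit_trans d r hs ⟨_, rfl⟩⟩, ?_⟩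
    apply Subtype.ext
    symm
    apply hdet
    exact ⟨σ, by rw [aux_mdelW_append, hσ, hτ]⟩
  have hinj : Function.Injective f := Finite.injective_iff_surjective.2 hsurj
  have hfs : f ⟨s, hs⟩ = ⟨u, hu⟩ :=
    Subtype.ext (hdet ⟨s, hs⟩ u (aux_orbit_refl d r _)).symm
  have path : ∀ (k : ℕ) (a : mOrbit d r t), ∃ z, JF d r t (a.1 ++ z ++ (f^[k+1] a).1) := by
    intro k
    induction k with
    | zero => intro a; exact ⟨[], by simpa using JF_orbit d r hJ (hf a)⟩
    | succ k ih =>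
      intro a
      obtain ⟨z, hz⟩ := ih a
      refine ⟨z ++ (f^[k+1] a).1, ?_⟩
      have := JF_concat d r hz (JF_orbit d r hJ (hf (f^[k+1] a)))
        (aux_orbit_length d r (f^[k+1] a).2)
      rw [Function.iterate_succ_apply' f (k+1)]
      simpa [List.append_assoc] using this
  obtain ⟨k, hk, hp⟩ := hinj.mem_periodicPts ⟨s, hs⟩
  obtain ⟨k, rfl⟩ := Nat.exists_eq_succ_of_ne_zero (Nat.pos_iff_ne_zero.1 hk)
  obtain ⟨z, hz⟩ := path (k + k) ⟨u, hu⟩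
  refine ⟨z, ?_⟩
  have h2 : f^[k + k + 1] ⟨u, hu⟩ = ⟨s, hs⟩ := by
    rw [← hfs, ← Function.iterate_succ_apply, show (k + k + 1).succ = (k+1) + (k+1) by omega,
      Function.iterate_add_apply]
    have hp' : f^[k + 1] ⟨s, hs⟩ = ⟨s, hs⟩ := hp
    rw [hp', hp']
  rw [h2] at hz
  exact hz

theorem stem_mem (d : A → Q → Q) (r : Q → A → A) {t u : List Q} (h : IsStem d r t u) :
    u ∈ mOrbit d r t := by
  have := h.1.1 t.length (by rw [h.2]) le_rfl
  rwa [List.take_length, ← h.2, List.take_length] at this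

theorem one_step [Fintype Q] [Fintype A] (d : A → Q → Q) (r : Q → A → A)
    (hi : MInvertible r) (hr : MReversible d)
    {t : List Q} (ht : IsJungleTrunk d r t) {s u v : List Q}
    (hs : IsStem d r t s) (hu : IsStem d r t u) (hv : IsStem d r t v)
    (h1 : IsJWord d r t (s ++ u)) (h2 : IsJWord d r t (s ++ v)) :
    StemEquiv d r t u v := by
  have J1 := JF_of_isJWord d r h1
  have J2 := JF_of_isJWord d r h2
  obtain ⟨z, hz⟩ := exists_return d r hi hr ht (stem_mem d r hs) (stem_mem d r hu) J1
  have hcu := JF_concat d r hz J1 hs.2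
  have hcv := JF_concat d r hz J2 hs.2
  have hpu : ∀ k, JF d r t (wpow (u ++ z ++ s) k ++ u) := by
    intro k
    induction k with
    | zero => exact JF_of_isJWord d r hu.1
    | succ k ih =>
      rw [wpow_succ']
      have := JF_concat (q := z ++ s ++ u) d r ih
        (by simpa [List.append_assoc] using hcu) hu.2
      simpa [List.append_assoc] using this
  obtain ⟨k, hk⟩ := exists_order d r hi hr ht (u ++ z ++ s) (by have := hu.2; simp; omega)
    (fun k => JF_left d r (hpu k))
  have he : u ++ (z ++ s ++ wpow (u ++ z ++ s) k) = wpow (u ++ z ++ s) (k + 1) := by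
    simp [wpow, List.append_assoc]
  refine ⟨z ++ s ++ wpow (u ++ z ++ s) k, ?_, ?_⟩
  · apply isJWord_of_JF
    · rw [he, wpow_succ']
      have := JF_concat (q := z ++ s ++ v) d r (hpu k)
        (by simpa [List.append_assoc] using hcv) hu.2
      simpa [List.append_assoc] using this
    · have := hu.2
      simp; omega
  · rw [he]; exact hk

theorem equiv_trans (d : A → Q → Q) (r : Q → A → A) {t u v w : List Q}
    (hu : u.length = t.length) (hv : v.length = t.length)
    (h1 : StemEquiv d r t u v) (h2 : StemEquiv d r t v w) : StemEquiv d r t u w := by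
  obtain ⟨a, ha, ha'⟩ := h1
  obtain ⟨b, hb, hb'⟩ := h2
  refine ⟨a ++ v ++ b, ?_, ?_⟩
  · apply isJWord_of_JF
    · have := JF_concat (q := b ++ w) d r (JF_of_isJWord d r ha)
        (by simpa [List.append_assoc] using JF_of_isJWord d r hb) hv
      simpa [List.append_assoc] using this
    · simp; omega
  · intro x
    rw [show u ++ (a ++ v ++ b) = (u ++ a) ++ (v ++ b) by simp [List.append_assoc],
      aux_mrhoW_append, ha', hb']

/-- The relation `∧` (the transitive closure of: `u ∧₀ v` iff there is a stem `s` with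
`s·u` and `s·v` both `j`-words) is finer than `∼`: `u ∧ v` implies `u ∼ v`. -/
theorem statement16 [Fintype Q] [Fintype A] [Nonempty Q] [Nonempty A]
    (d : A → Q → Q) (r : Q → A → A)
    (hbi : MBireversible d r) (hconn : MConnected d r)
    (hnab : ¬ HasActiveSelfLiftableBranch d r)
    (t : List Q) (ht : IsJungleTrunk d r t)
    (u v : List Q)
    (h : Relation.TransGen
      (fun a b : List Q => IsStem d r t a ∧ IsStem d r t b ∧
        ∃ s : List Q, IsStem d r t s ∧ IsJWord d r t (s ++ a) ∧ IsJWord d r t (s ++ b))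
      u v) :
    StemEquiv d r t u v := by
  induction h with
  | single h =>
    obtain ⟨hu, hv, s, hs, h1, h2⟩ := h
    exact one_step d r hbi.1 hbi.2.1 ht hs hu hv h1 h2
  | tail h0 h ih =>
    obtain ⟨hb, hc, s, hs, h1, h2⟩ := h
    have hu : IsStem d r t u := by
      obtain ⟨_, h', -⟩ := Relation.TransGen.head'_iff.1 h0
      exact h'.1
    exact equiv_trans d r hu.2 hb.2 ih (one_step d r hbi.1 hbi.2.1 ht hs hb hc h1 h2)
end
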